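/- The space of holomorphic functions is a Montel space in the following sense: let Ω be an open subset of ℂⁿ (functions Fin n → ℂ) and let S be a subset of C(Ω, ℂ) (continuous maps with the compact-open topology) consisting of functions holomorphic on Ω. If S is von Neumann bounded (i.e. S is absorbed by every neighbourhood of 0 in the topological vector space C(Ω, ℂ)), then the closure of S in C(Ω, ℂ) is compact and every element of this closure is holomorphic on Ω. -/

import Mathlib

open Set Filter Topology Metric

section HolomorphicFamilies

variable {E F : Type*} [NormedAddCommGroup E] [NormedSpace ℂ E] [NormedAddCommGroup F]
  [NormedSpace ℂ F]

/-- **Cauchy's estimate** for the derivative of a function bounded on a ball. -/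
theorem norm_fderiv_le_of_forall_mem_ball_norm_le {f : E → F} {c : E} {R M : ℝ} (hR : 0 < R)
    (hf : DifferentiableOn ℂ f (ball c R)) (hM : ∀ z ∈ ball c R, ‖f z‖ ≤ M) :
    ‖fderiv ℂ f c‖ ≤ 2 * M / R := by
  refine Complex.norm_fderiv_le_div_of_mapsTo_ball hf (fun z hz ↦ ?_) hR
  rw [mem_closedBall, dist_eq_norm]
  linarith [norm_sub_le (f z) (f c), hM z hz, hM c (mem_ball_self hR)]

/-- A function differentiable and bounded on a ball is Lipschitz at the centre, with an explicit
constant. -/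
theorem dist_le_of_forall_mem_ball_norm_le {f : E → F} {c z : E} {R M : ℝ}
    (hf : DifferentiableOn ℂ f (ball c R)) (hM : ∀ z ∈ ball c R, ‖f z‖ ≤ M) (hz : z ∈ ball c R) :
    dist (f z) (f c) ≤ 2 * M / R * dist z c := by
  have hR : 0 < R := nonempty_ball.mp ⟨z, hz⟩
  refine Complex.dist_le_div_mul_dist_of_mapsTo_ball hf (fun w hw ↦ ?_) hz
  rw [mem_closedBall, dist_eq_norm]
  linarith [norm_sub_le (f w) (f c), hM w hw, hM c (mem_ball_self hR)]

/-- A uniform limit of differentiable functions on a ball is differentiable at the centre. -/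
theorem TendstoUniformlyOn.differentiableAt_of_ball [CompleteSpace F] {ι : Type*} {l : Filter ι}
    [NeBot l] {f : ι → E → F} {g : E → F} {c : E} {R : ℝ} (hR : 0 < R)
    (hfg : TendstoUniformlyOn f g l (ball c R))
    (hf : ∀ i, DifferentiableOn ℂ (f i) (ball c R)) : DifferentiableAt ℂ g c := by
  have hsub : ∀ y ∈ ball c (R / 2), ball y (R / 2) ⊆ ball c R := fun y hy ↦
    ball_subset_ball' (by linarith [mem_ball.mp hy])
  have hmono : ball c (R / 2) ⊆ ball c R := ball_subset_ball (by linarith)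
  have hdiff : ∀ i, ∀ y ∈ ball c R, DifferentiableAt ℂ (f i) y := fun i y hy ↦
    (hf i).differentiableAt (isOpen_ball.mem_nhds hy)
  have hcauchy : UniformCauchySeqOn (fun i ↦ fderiv ℂ (f i)) l (ball c (R / 2)) := by
    intro u hu
    obtain ⟨ε, hε, hu⟩ := Metric.mem_uniformity_dist.mp hu
    filter_upwards [hfg.uniformCauchySeqOn _
      (Metric.dist_mem_uniformity (show 0 < ε * R / 8 by positivity))] with m hm y hy
    refine hu ?_
    have hy' := hmono hy
    rw [dist_eq_norm, ← fderiv_sub (hdiff m.1 y hy') (hdiff m.2 y hy')]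
    refine (norm_fderiv_le_of_forall_mem_ball_norm_le (half_pos hR)
      (((hf m.1).sub (hf m.2)).mono (hsub y hy)) (M := ε * R / 8) fun z hz ↦ ?_).trans_lt ?_
    · simpa [dist_eq_norm] using (show dist _ _ < _ from hm z (hsub y hy hz)).le
    · have : 2 * (ε * R / 8) / (R / 2) = ε / 2 := by field_simp; norm_num
      linarith
  choose! g' hg' using fun y (hy : y ∈ ball c (R / 2)) ↦
    cauchy_iff_exists_le_nhds.mp (hcauchy.cauchy_map hy)
  exact (hasFDerivAt_of_tendstoUniformlyOn isOpen_ball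
    (hcauchy.tendstoUniformlyOn_of_tendsto hg')
    (fun i y hy ↦ (hdiff i y (hmono hy)).hasFDerivAt)
    (fun y hy ↦ hfg.tendsto_at (hmono hy)) (mem_ball_self (half_pos hR))).differentiableAt

end HolomorphicFamilies

/-- A von Neumann bounded set of continuous functions is uniformly bounded on compact sets. -/
theorem Bornology.IsVonNBounded.exists_forall_norm_le_of_isCompact {X : Type*} [TopologicalSpace X]
    {S : Set C(X, ℂ)} (hS : Bornology.IsVonNBounded ℂ S) {K : Set X} (hK : IsCompact K) :
    ∃ M : ℝ, ∀ f ∈ S, ∀ x ∈ K, ‖f x‖ ≤ M := by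
  have hU : {f : C(X, ℂ) | MapsTo f K (ball 0 1)} ∈ 𝓝 0 :=
    (ContinuousMap.isOpen_setOfPred_mapsTo hK isOpen_ball).mem_nhds fun x _ ↦ by simp
  obtain ⟨r, hr, h⟩ := (hS hU).exists_pos
  refine ⟨r, fun f hf x hx ↦ ?_⟩
  obtain ⟨g, hg, rfl⟩ := h (r : ℂ) (by simp [abs_of_pos hr]) hf
  have hgx : ‖g x‖ < 1 := by simpa using hg hx
  simpa [abs_of_pos hr] using mul_le_of_le_one_right hr.le hgx.le

/-- **Arzelà–Ascoli**: an equicontinuous, pointwise bounded family of continuous functions on a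
locally compact space has compact closure in the compact-open topology. -/
theorem ContinuousMap.isCompact_closure_of_equicontinuous {X α : Type*} [TopologicalSpace X]
    [WeaklyLocallyCompactSpace X] [MetricSpace α] [ProperSpace α] {S : Set C(X, α)}
    (hS : Equicontinuous fun (f : S) (x : X) ↦ (f : C(X, α)) x)
    (hbdd : ∀ x, Bornology.IsBounded ((fun f : C(X, α) ↦ f x) '' S)) : IsCompact (closure S) := by
  have : T2Space (UniformOnFun X α {K | IsCompact K}) :=
    UniformOnFun.t2Space_of_covering sUnion_isCompact_eq_univ
  exact ArzelaAscoli.isCompact_closure_of_isClosedEmbedding (𝔖 := {K : Set X | IsCompact K})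
    (F := fun (f : C(X, α)) (x : X) ↦ f x) (fun _ hK ↦ hK)
    ContinuousMap.isUniformEmbedding_toUniformOnFunIsCompact.isClosedEmbedding
    (fun K _ ↦ hS.equicontinuousOn K)
    fun _ _ x _ ↦ ⟨_, (hbdd x).isCompact_closure, fun f hf ↦ subset_closure ⟨f, hf, rfl⟩⟩

/-- Montel space property: if `S ⊆ C(Ω, ℂ)` consists of functions holomorphic
on the open set `Ω ⊆ ℂⁿ` and `S` is von Neumann bounded in the topological vector space
`C(Ω, ℂ)` (compact-open topology), then the closure of `S` is compact and consists of
holomorphic functions. -/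
theorem montel_space_holomorphic (n : ℕ) (Ω : Set (Fin n → ℂ)) (hΩ : IsOpen Ω)
    (S : Set C(Ω, ℂ))
    (hhol : ∀ f ∈ S, ∃ g : (Fin n → ℂ) → ℂ, DifferentiableOn ℂ g Ω ∧ ∀ x : Ω, f x = g x)
    (hbdd : Bornology.IsVonNBounded ℂ S) :
    IsCompact (closure S) ∧
      ∀ f ∈ closure S, ∃ g : (Fin n → ℂ) → ℂ, DifferentiableOn ℂ g Ω ∧ ∀ x : Ω, f x = g x := by
  have : LocallyCompactSpace Ω := hΩ.locallyCompactSpace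
  have hball : ∀ x ∈ Ω, ∃ R > 0, closedBall x R ⊆ Ω ∧
      IsCompact ((↑) ⁻¹' closedBall x R : Set Ω) := fun x hx ↦ by
    obtain ⟨R, hR, hRΩ⟩ := nhds_basis_closedBall.mem_iff.mp (hΩ.mem_nhds hx)
    exact ⟨R, hR, hRΩ, IsInducing.subtypeVal.isCompact_preimage' (isCompact_closedBall x R)
      (by simpa using hRΩ)⟩
  choose! G hG hfG using hhol
  refine ⟨ContinuousMap.isCompact_closure_of_equicontinuous (fun x ↦ ?_) fun x ↦ ?_,
    fun f hf ↦ ?_⟩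
  · obtain ⟨R, hR, hRΩ, hK⟩ := hball x x.2
    obtain ⟨M, hM⟩ := hbdd.exists_forall_norm_le_of_isCompact hK
    refine Metric.equicontinuousAt_of_continuity_modulus (fun y : Ω ↦ 2 * M / R * dist y x)
      ?_ _ ?_
    · have : Continuous fun y : Ω ↦ 2 * M / R * dist y x := by fun_prop
      simpa using this.tendsto x
    · filter_upwards [ball_mem_nhds x hR] with y hy f
      rw [dist_comm, hfG f f.2, hfG f f.2]
      refine dist_le_of_forall_mem_ball_norm_le
        ((hG f f.2).mono (ball_subset_closedBall.trans hRΩ)) (fun z hz ↦ ?_) hy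
      have hz' := ball_subset_closedBall hz
      simpa [hfG f f.2] using hM f f.2 ⟨z, hRΩ hz'⟩ hz'
  · obtain ⟨M, hM⟩ := hbdd.exists_forall_norm_le_of_isCompact (isCompact_singleton (x := x))
    exact isBounded_iff_forall_norm_le.mpr ⟨M, by rintro _ ⟨f, hf, rfl⟩; exact hM f hf x rfl⟩
  · have hext : ∀ x : Ω, f x = Function.extend Subtype.val f 0 (x : Fin n → ℂ) := fun x ↦
      (Subtype.val_injective.extend_apply f 0 x).symm
    refine ⟨Function.extend Subtype.val f 0, fun x hx ↦ ?_, hext⟩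
    obtain ⟨R, hR, hRΩ, hK⟩ := hball x hx
    have : NeBot (comap ((↑) : S → C(Ω, ℂ)) (𝓝 f)) := mem_closure_iff_comap_neBot.mp hf
    have hlim := ContinuousMap.tendsto_iff_forall_isCompact_tendstoUniformlyOn.mp
      (tendsto_comap : Tendsto ((↑) : S → C(Ω, ℂ)) _ (𝓝 f)) _ hK
    refine (TendstoUniformlyOn.differentiableAt_of_ball 
      (l := comap ((↑) : S → C(Ω, ℂ)) (𝓝 f)) (f := fun s : S ↦ G s) hR
      (fun u hu ↦ ?_) fun s ↦
        (hG s s.2).mono (ball_subset_closedBall.trans hRΩ)).differentiableWithinAt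
    filter_upwards [hlim u hu] with s hs y hy
    have hy' := ball_subset_closedBall hy
    simpa [hext, hfG s s.2] using hs ⟨y, hRΩ hy'⟩ hy'
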